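/- Let G = (Q, A, π, V) be a two-prover one-round game with symmetric distribution π on Q × Q, and define its classical value ω(G) = max over functions f, g : Q → A of Σ_{(q,q')} π(q,q') V(f(q), g(q') | q, q'). Let H be a finite-dimensional complex Hilbert space, ψ ∈ H ⊗ H ⊗ H a unit vector invariant under all permutations of the three tensor factors, and {W_q^a}_{a∈A} a projective measurement on H for each q ∈ Q. Suppose the classical test succeeds with probability π₁ = Σ_{q,q'} π(q,q') Σ_{a,a'} V(a, a' | q, q') ⟨ψ| W_q^a ⊗ W_{q'}^{a'} ⊗ Id |ψ⟩ ≥ 1 − ε and the consistency test succeeds with probability π₂ = Σ_q π(q) Σ_a ⟨ψ| W_q^a ⊗ W_q^a ⊗ Id |ψ⟩ ≥ 1 − ε, where π(q) is the marginal of π. Then ω(G) ≥ 1 − ε − 12·|Q|·√ε. -/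

import Mathlib

open scoped Kronecker

/-- Squared ℓ²-norm of a vector in a finite-dimensional complex Hilbert space. -/
noncomputable def nsq {ι : Type*} [Fintype ι] (v : ι → ℂ) : ℝ := ∑ i, ‖v i‖ ^ 2

/-- The (real) expectation value `⟨ψ| M |ψ⟩`. -/
noncomputable def expval {ι : Type*} [Fintype ι] (M : Matrix ι ι ℂ) (ψ : ι → ℂ) : ℝ :=
  (∑ p, (starRingEnd ℂ) (ψ p) * M.mulVec ψ p).re

/-- A projective measurement with outcome set `A`: a family of orthogonal projections
summing to the identity. -/
def IsProjMeas {n : Type*} [Fintype n] [DecidableEq n] {A : Type*} [Fintype A]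
    (W : A → Matrix n n ℂ) : Prop :=
  (∀ a, (W a).IsHermitian) ∧ (∀ a, W a * W a = W a) ∧ (∑ a, W a) = 1

/-- The classical value of a two-prover one-round game: the best winning probability over
(deterministic) strategies `f, g : Q → A`. -/
noncomputable def gameValue {Q A : Type*} [Fintype Q]
    (π : Q → Q → ℝ) (V : A → A → Q → Q → Bool) : ℝ :=
  ⨆ f : Q → A, ⨆ g : Q → A,
    ∑ q, ∑ q', π q q' * (if V (f q) (g q') q q' then (1 : ℝ) else 0)

theorem dependsOn_pair {Q A : Type*} (G : A → A → ℝ) (i j : Q) :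
    DependsOn (fun f : Q → A => G (f i) (f j)) {i, j} := by
  intro f g h
  simp only [h i (by simp), h j (by simp)]

section SequentialMeasurement

variable {K : Type*} [NormedAddCommGroup K] [InnerProductSpace ℂ K]
  {Q A : Type*} [Fintype A]

/-- The real expectation value `⟨ψ| T |ψ⟩` of a bounded operator. -/
noncomputable def opExp (ψ : K) (T : K →L[ℂ] K) : ℝ := (inner ℂ ψ (T ψ)).re

theorem opExp_sum {ι : Type*} (ψ : K) (s : Finset ι) (T : ι → K →L[ℂ] K) :
    opExp ψ (∑ i ∈ s, T i) = ∑ i ∈ s, opExp ψ (T i) := by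
  simp [opExp]

theorem opExp_smul (ψ : K) (c : ℝ) (T : K →L[ℂ] K) :
    opExp ψ ((c : ℂ) • T) = c * opExp ψ T := by
  simp [opExp]

/-- The probability that measuring the same question on two of the registers gives different
answers. -/
noncomputable def inconsistency (P R : Q → A → K →L[ℂ] K) (ψ : K) (q : Q) : ℝ :=
  1 - ∑ a, opExp ψ (P q a * R q a)

/-- The error caused by one measurement step. -/
noncomputable def stepError (P R : Q → A → K →L[ℂ] K) (ψ : K) (q : Q) : ℝ :=
  2 * √(2 * inconsistency P R ψ q)

theorem stepError_nonneg (P R : Q → A → K →L[ℂ] K) (ψ : K) (q : Q) : 0 ≤ stepError P R ψ q := by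
  unfold stepError; positivity

section

variable [DecidableEq Q]

/-- The observable for `F` evaluated at the assignment obtained by measuring, one after the other,
the questions of a list and overwriting the initial assignment by the outcomes. -/
noncomputable def seqMeas (P : Q → A → K →L[ℂ] K) (F : (Q → A) → ℝ) :
    List Q → (Q → A) → K →L[ℂ] K
  | [], f => (F f : ℂ) • 1
  | k :: l, f => ∑ a, P k a * seqMeas P F l (Function.update f k a) * P k a

variable {P : Q → A → K →L[ℂ] K}

theorem commute_seqMeas {T : K →L[ℂ] K} (hT : ∀ q a, Commute T (P q a)) (F : (Q → A) → ℝ)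
    (l : List Q) (f : Q → A) : Commute T (seqMeas P F l f) := by
  induction l generalizing f with
  | nil => exact (Commute.one_right T).smul_right _
  | cons k l ih =>
    exact Commute.sum_right _ _ _ fun a _ => ((hT k a).mul_right (ih _)).mul_right (hT k a)

theorem seqMeas_congr {F : (Q → A) → ℝ} {s : Set Q} (hF : DependsOn F s) (l : List Q)
    {f g : Q → A} (hfg : ∀ x ∈ s, x ∉ l → f x = g x) : seqMeas P F l f = seqMeas P F l g := by
  induction l generalizing f g with
  | nil => simp only [seqMeas, hF fun x hx => hfg x hx (by simp)]
  | cons k l ih =>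
    refine Finset.sum_congr rfl fun a _ => ?_
    rw [ih fun x hx hxl => ?_]
    by_cases h : x = k
    · simp [h]
    · simp [h, hfg x hx (by simp [h, hxl])]

theorem seqMeas_sum {ι : Type*} (s : Finset ι) (c : ι → ℝ) (F : ι → (Q → A) → ℝ) (l : List Q)
    (f : Q → A) : seqMeas P (fun f => ∑ i ∈ s, c i * F i f) l f
      = ∑ i ∈ s, (c i : ℂ) • seqMeas P (F i) l f := by
  induction l generalizing f with
  | nil =>
    simp only [seqMeas, smul_smul]
    rw [← Finset.sum_smul]
    push_cast
    rfl
  | cons k l ih =>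
    simp only [seqMeas, ih, Finset.mul_sum, Finset.sum_mul, Finset.smul_sum, mul_smul_comm,
      smul_mul_assoc]
    rw [Finset.sum_comm]

end

variable [CompleteSpace K]

theorem IsStarProjection.inner_apply_left {P : K →L[ℂ] K} (hP : IsStarProjection P) (u v : K) :
    inner ℂ (P u) v = inner ℂ u (P v) := by
  rw [← ContinuousLinearMap.adjoint_inner_right, ← ContinuousLinearMap.star_eq_adjoint,
    hP.isSelfAdjoint.star_eq]

theorem IsStarProjection.apply_apply {P : K →L[ℂ] K} (hP : IsStarProjection P) (v : K) :
    P (P v) = P v :=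
  congrArg (fun T : K →L[ℂ] K => T v) hP.isIdempotentElem.eq

theorem IsStarProjection.opExp_conj {P : K →L[ℂ] K} (hP : IsStarProjection P) (ψ : K)
    (T : K →L[ℂ] K) : opExp ψ (P * T * P) = opExp (P ψ) T := by
  simp only [opExp, mul_apply_eq_comp, hP.inner_apply_left]

theorem IsStarProjection.norm_sq_apply {P : K →L[ℂ] K} (hP : IsStarProjection P) (v : K) :
    ‖P v‖ ^ 2 = opExp v P := by
  rw [opExp, ← hP.apply_apply v, ← hP.inner_apply_left, hP.apply_apply,
    ← inner_self_eq_norm_sq (𝕜 := ℂ)]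
  rfl

/-- A projective measurement by bounded operators on a Hilbert space. -/
structure IsOpMeas (P : A → K →L[ℂ] K) : Prop where
  proj : ∀ a, IsStarProjection (P a)
  sum_eq : ∑ a, P a = 1

/-- `T` does not increase norms. -/
def IsContr (T : K →L[ℂ] K) : Prop := ∀ v, ‖T v‖ ≤ ‖v‖

namespace IsOpMeas

variable {P R : A → K →L[ℂ] K}

theorem sum_norm_sq (hP : IsOpMeas P) (v : K) : ∑ a, ‖P a v‖ ^ 2 = ‖v‖ ^ 2 := by
  simp only [(hP.proj _).norm_sq_apply]
  rw [← opExp_sum, hP.sum_eq, opExp, ← inner_self_eq_norm_sq (𝕜 := ℂ)]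
  rfl

theorem mul_eq_zero (hP : IsOpMeas P) {a b : A} (hab : a ≠ b) : P b * P a = 0 := by
  classical
  ext v
  have h := hP.sum_norm_sq (P a v)
  rw [← Finset.add_sum_erase _ _ (Finset.mem_univ a), (hP.proj a).apply_apply] at h
  have h0 : ∑ c ∈ Finset.univ.erase a, ‖P c (P a v)‖ ^ 2 = 0 := by linarith
  rw [Finset.sum_eq_zero_iff_of_nonneg fun _ _ => by positivity] at h0
  simpa using h0 b (by simp [hab.symm])

/-- The pinching of contractions along a measurement is a contraction. -/
theorem isContr_pinch (hP : IsOpMeas P) {X : A → K →L[ℂ] K} (hX : ∀ a, IsContr (X a)) :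
    IsContr (∑ a, P a * X a * P a) := by
  intro v
  set z := (∑ a, P a * X a * P a) v with hz
  have key : ‖z‖ ^ 2 ≤ ‖z‖ * ‖v‖ := by
    calc ‖z‖ ^ 2 = ‖inner ℂ z z‖ := by
          rw [inner_self_eq_norm_sq_to_K]; simp
      _ = ‖∑ a, inner ℂ (P a z) (X a (P a v))‖ := by
          congr 1
          nth_rewrite 2 [hz]
          simp only [sum_apply, inner_sum, mul_apply_eq_comp, (hP.proj _).inner_apply_left]
      _ ≤ ∑ a, ‖P a z‖ * ‖P a v‖ := by
          refine (norm_sum_le _ _).trans (Finset.sum_le_sum fun a _ => ?_)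
          refine (norm_inner_le_norm _ _).trans ?_
          gcongr
          exact hX a _
      _ ≤ √(∑ a, ‖P a z‖ ^ 2) * √(∑ a, ‖P a v‖ ^ 2) := Real.sum_mul_le_sqrt_mul_sqrt _ _ _
      _ = ‖z‖ * ‖v‖ := by
          rw [hP.sum_norm_sq, hP.sum_norm_sq, Real.sqrt_sq (norm_nonneg _),
            Real.sqrt_sq (norm_nonneg _)]
  rcases (norm_nonneg z).eq_or_lt with h | h
  · rw [← h]; positivity
  · nlinarith

theorem opExp_mul (hP : IsOpMeas P) (ψ : K) (a : A) (T : K →L[ℂ] K) :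
    opExp ψ (P a * T) = (inner ℂ (P a ψ) (T ψ)).re := by
  simp [opExp, (hP.proj _).inner_apply_left]

theorem sum_norm_sub_sq (hP : IsOpMeas P) (hR : IsOpMeas R) {ψ : K} (hψ : ‖ψ‖ = 1) :
    ∑ a, ‖P a ψ - R a ψ‖ ^ 2 = 2 * (1 - ∑ a, opExp ψ (P a * R a)) := by
  have h (a : A) : ‖P a ψ - R a ψ‖ ^ 2
      = ‖P a ψ‖ ^ 2 - 2 * opExp ψ (P a * R a) + ‖R a ψ‖ ^ 2 := by
    rw [hP.opExp_mul, @norm_sub_sq ℂ]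
    rfl
  simp only [h, Finset.sum_add_distrib, Finset.sum_sub_distrib, ← Finset.mul_sum,
    hP.sum_norm_sq, hR.sum_norm_sq, hψ]
  ring

theorem sum_opExp_mul_le_one (hP : IsOpMeas P) (hR : IsOpMeas R) {ψ : K} (hψ : ‖ψ‖ = 1) :
    ∑ a, opExp ψ (P a * R a) ≤ 1 := by
  have h := hP.sum_norm_sub_sq hR hψ
  have : 0 ≤ ∑ a, ‖P a ψ - R a ψ‖ ^ 2 := by positivity
  linarith

/-- If two measurements are consistent on `ψ`, pinching along one or the other gives nearly the
same expectation value. -/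
theorem abs_opExp_pinch_sub_le (hP : IsOpMeas P) (hR : IsOpMeas R) {ψ : K} (hψ : ‖ψ‖ = 1)
    {X : A → K →L[ℂ] K} (hX : ∀ a, IsContr (X a)) :
    |opExp ψ (∑ a, P a * X a * P a) - opExp ψ (∑ a, R a * X a * R a)|
      ≤ 2 * √(2 * (1 - ∑ a, opExp ψ (P a * R a))) := by
  simp only [opExp_sum, (hP.proj _).opExp_conj, (hR.proj _).opExp_conj]
  rw [← Finset.sum_sub_distrib]
  have step (a : A) : |opExp (P a ψ) (X a) - opExp (R a ψ) (X a)|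
      ≤ ‖P a ψ - R a ψ‖ * (‖P a ψ‖ + ‖R a ψ‖) := by
    set u := P a ψ
    set v := R a ψ
    have h : inner ℂ u (X a u) - inner ℂ v (X a v)
        = inner ℂ (u - v) (X a u) + inner ℂ v (X a (u - v)) := by
      simp only [map_sub, inner_sub_left, inner_sub_right]; ring
    have h1 := norm_inner_le_norm (𝕜 := ℂ) (u - v) (X a u)
    have h2 := norm_inner_le_norm (𝕜 := ℂ) v (X a (u - v))
    have h3 := mul_le_mul_of_nonneg_left (hX a u) (norm_nonneg (u - v))
    have h4 := mul_le_mul_of_nonneg_left (hX a (u - v)) (norm_nonneg v)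
    rw [opExp, opExp, ← Complex.sub_re, h]
    refine (Complex.abs_re_le_norm _).trans ((norm_add_le _ _).trans ?_)
    nlinarith
  have hsum : ∑ a, (‖P a ψ‖ + ‖R a ψ‖) ^ 2 ≤ 2 ^ 2 := by
    calc ∑ a, (‖P a ψ‖ + ‖R a ψ‖) ^ 2 ≤ ∑ a, (2 * ‖P a ψ‖ ^ 2 + 2 * ‖R a ψ‖ ^ 2) :=
          Finset.sum_le_sum fun a _ => by nlinarith [sq_nonneg (‖P a ψ‖ - ‖R a ψ‖)]
      _ = 2 ^ 2 := by
          rw [Finset.sum_add_distrib, ← Finset.mul_sum, ← Finset.mul_sum, hP.sum_norm_sq,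
            hR.sum_norm_sq, hψ]
          norm_num
  calc |∑ a, (opExp (P a ψ) (X a) - opExp (R a ψ) (X a))|
      ≤ ∑ a, ‖P a ψ - R a ψ‖ * (‖P a ψ‖ + ‖R a ψ‖) :=
        (Finset.abs_sum_le_sum_abs _ _).trans (Finset.sum_le_sum fun a _ => step a)
    _ ≤ √(∑ a, ‖P a ψ - R a ψ‖ ^ 2) * √(∑ a, (‖P a ψ‖ + ‖R a ψ‖) ^ 2) :=
        Real.sum_mul_le_sqrt_mul_sqrt _ _ _
    _ ≤ √(2 * (1 - ∑ a, opExp ψ (P a * R a))) * 2 := by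
        rw [hP.sum_norm_sub_sq hR hψ]
        gcongr
        exact Real.sqrt_le_iff.mpr ⟨by norm_num, hsum⟩
    _ = _ := mul_comm _ _

/-- A measurement consistent on `ψ` with one that commutes with `T` hardly disturbs the
expectation value of `T`. -/
theorem abs_opExp_pinch_sub_self_le (hP : IsOpMeas P) (hR : IsOpMeas R) {ψ : K} (hψ : ‖ψ‖ = 1)
    {T : K →L[ℂ] K} (hT : IsContr T) (hRT : ∀ a, Commute (R a) T) :
    |opExp ψ (∑ a, P a * T * P a) - opExp ψ T|
      ≤ 2 * √(2 * (1 - ∑ a, opExp ψ (P a * R a))) := by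
  have h := hP.abs_opExp_pinch_sub_le hR hψ (X := fun _ => T) fun _ => hT
  have h2 : ∑ a, R a * T * R a = T := by
    simp only [(hRT _).eq, mul_assoc, (hR.proj _).isIdempotentElem.eq]
    rw [← Finset.mul_sum, hR.sum_eq, mul_one]
  rwa [h2] at h

end IsOpMeas

section

variable [DecidableEq Q] {P : Q → A → K →L[ℂ] K}

theorem isContr_seqMeas (hP : ∀ q, IsOpMeas (P q)) {F : (Q → A) → ℝ} (hF : ∀ f, |F f| ≤ 1)
    (l : List Q) (f : Q → A) : IsContr (seqMeas P F l f) := by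
  induction l generalizing f with
  | nil =>
    intro v
    simpa [seqMeas, norm_smul] using mul_le_mul_of_nonneg_right (hF f) (norm_nonneg v)
  | cons k l ih => exact (hP k).isContr_pinch fun a => ih _

theorem seqMeas_eq_smul_one (hP : ∀ q, IsOpMeas (P q)) {F : (Q → A) → ℝ} {s : Set Q}
    (hF : DependsOn F s) (l : List Q) (hl : ∀ x ∈ s, x ∉ l) (f : Q → A) :
    seqMeas P F l f = (F f : ℂ) • 1 := by
  induction l generalizing f with
  | nil => rfl
  | cons k l ih =>
    have h (a : A) : F (Function.update f k a) = F f :=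
      hF fun x hx => Function.update_of_ne (fun h => hl x hx (by simp [h])) _ _
    simp only [seqMeas]
    simp only [ih fun x hx hxl => hl x hx (List.mem_cons_of_mem _ hxl), h, mul_smul_comm,
      smul_mul_assoc, mul_one, ((hP k).proj _).isIdempotentElem.eq]
    rw [← Finset.smul_sum, (hP k).sum_eq]

theorem opExp_seqMeas_le (hP : ∀ q, IsOpMeas (P q)) {F : (Q → A) → ℝ} {c : ℝ} (hF : ∀ f, F f ≤ c)
    (l : List Q) (f : Q → A) (v : K) : opExp v (seqMeas P F l f) ≤ c * ‖v‖ ^ 2 := by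
  induction l generalizing f v with
  | nil =>
    have : opExp v (1 : K →L[ℂ] K) = ‖v‖ ^ 2 := inner_self_eq_norm_sq (𝕜 := ℂ) v
    rw [seqMeas, opExp_smul, this]
    gcongr
    exact hF f
  | cons k l ih =>
    rw [seqMeas, opExp_sum, ← (hP k).sum_norm_sq, Finset.mul_sum]
    exact Finset.sum_le_sum fun a _ => by rw [((hP k).proj a).opExp_conj]; exact ih _ _

end

/-- Three pairwise commuting copies of a family of measurements, with a state on which they are
exchangeable. -/
structure IsTriple (P R S : Q → A → K →L[ℂ] K) (ψ : K) : Prop where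
  norm_eq : ‖ψ‖ = 1
  measP : ∀ q, IsOpMeas (P q)
  measR : ∀ q, IsOpMeas (R q)
  measS : ∀ q, IsOpMeas (S q)
  commRP : ∀ q a q' a', Commute (R q a) (P q' a')
  commSP : ∀ q a q' a', Commute (S q a) (P q' a')
  commSR : ∀ q a q' a', Commute (S q a) (R q' a')
  symm : ∀ q a q' a', opExp ψ (P q a * R q' a') = opExp ψ (P q' a' * R q a)
  eqS : ∀ q a, opExp ψ (P q a * S q a) = opExp ψ (P q a * R q a)

namespace IsTriple

variable {P R S : Q → A → K →L[ℂ] K} {ψ : K}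

theorem pinch_le (h : IsTriple P R S ψ) (q : Q) {T : K →L[ℂ] K} (hT : IsContr T)
    (hST : ∀ a, Commute (S q a) T) :
    |opExp ψ (∑ a, P q a * T * P q a) - opExp ψ T| ≤ stepError P R ψ q := by
  have := (h.measP q).abs_opExp_pinch_sub_self_le (h.measS q) h.norm_eq hT hST
  rw [stepError, inconsistency]
  simpa only [h.eqS] using this

theorem transfer_le (h : IsTriple P R S ψ) (q : Q) {X : A → K →L[ℂ] K} (hX : ∀ a, IsContr (X a))
    (hRX : ∀ a, Commute (R q a) (X a)) :
    |opExp ψ (∑ a, P q a * X a * P q a) - ∑ a, opExp ψ (X a * R q a)| ≤ stepError P R ψ q := by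
  have := (h.measP q).abs_opExp_pinch_sub_le (h.measR q) h.norm_eq hX
  rw [stepError, inconsistency]
  simpa only [opExp_sum, (hRX _).eq, mul_assoc, ((h.measR q).proj _).isIdempotentElem.eq] using this

theorem inconsistency_nonneg (h : IsTriple P R S ψ) (q : Q) : 0 ≤ inconsistency P R ψ q :=
  sub_nonneg.mpr ((h.measP q).sum_opExp_mul_le_one (h.measR q) h.norm_eq)

variable [DecidableEq Q]

theorem abs_sum_opExp_seqMeas_mul_sub_le (h : IsTriple P R S ψ) {G : A → A → ℝ}
    (hG : ∀ a b, |G a b| ≤ 1) {i j : Q} (l : List Q) (hl : l.Nodup)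
    (hs : l.Pairwise fun x y => stepError P R ψ x ≤ stepError P R ψ y) (hi : i ∉ l) (hj : j ∈ l)
    (f : Q → A) :
    |∑ a, opExp ψ (seqMeas P (fun f => G (f i) (f j)) l (Function.update f i a) * R i a)
      - ∑ a, ∑ b, G a b * opExp ψ (P i a * R j b)| ≤ l.length * stepError P R ψ j := by
  set F : (Q → A) → ℝ := fun f => G (f i) (f j) with hF
  have hdep : DependsOn F {i, j} := dependsOn_pair G i j
  induction l with
  | nil => simp at hj
  | cons k l ih =>
    have hki : k ≠ i := fun e => hi (by simp [e])
    have hil : i ∉ l := fun e => hi (by simp [e])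
    rw [List.nodup_cons] at hl
    rw [List.pairwise_cons] at hs
    by_cases hkj : k = j
    · subst hkj
      have hE (a : A) : seqMeas P F (k :: l) (Function.update f i a) = ∑ b, (G a b : ℂ) • P k b := by
        rw [seqMeas]
        refine Finset.sum_congr rfl fun b _ => ?_
        rw [seqMeas_eq_smul_one h.measP hdep]
        · simp [hF, hki.symm, ((h.measP k).proj b).isIdempotentElem.eq]
        · rintro x (rfl | rfl)
          exacts [hil, hl.1]
      have : ∑ a, opExp ψ (seqMeas P F (k :: l) (Function.update f i a) * R i a)
          = ∑ a, ∑ b, G a b * opExp ψ (P i a * R k b) := by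
        simp only [hE, Finset.sum_mul, smul_mul_assoc, opExp_sum, opExp_smul, h.symm i _ k]
      rw [this, sub_self, abs_zero]
      exact mul_nonneg (Nat.cast_nonneg _) (stepError_nonneg P R ψ _)
    · have hjl : j ∈ l := by simpa [Ne.symm hkj] using hj
      set X : A → K →L[ℂ] K := fun a => seqMeas P F l (Function.update f i a) with hX
      have hXE (a b : A) : seqMeas P F l (Function.update (Function.update f i a) k b) = X a := by
        refine seqMeas_congr hdep l ?_
        rintro x (rfl | rfl) hx
        · simp [hki.symm]
        · exact absurd hjl hx
      have hXR (a : A) : R i a * X a * R i a = X a * R i a := by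
        rw [(commute_seqMeas (fun q b => h.commRP i a q b) F l _).eq, mul_assoc,
          ((h.measR i).proj a).isIdempotentElem.eq]
      have hT : IsContr (∑ a, X a * R i a) := by
        have := (h.measR i).isContr_pinch (X := X) fun a =>
          isContr_seqMeas h.measP (fun f => hG _ _) l _
        simpa only [hXR] using this
      have hST (b : A) : Commute (S k b) (∑ a, X a * R i a) :=
        Commute.sum_right _ _ _ fun a _ =>
          (commute_seqMeas (fun q c => h.commSP k b q c) F l _).mul_right (h.commSR k b i a)
      have hE : ∑ a, opExp ψ (seqMeas P F (k :: l) (Function.update f i a) * R i a)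
          = opExp ψ (∑ b, P k b * (∑ a, X a * R i a) * P k b) := by
        rw [← opExp_sum]
        congr 1
        simp only [seqMeas, hXE, Finset.sum_mul, Finset.mul_sum]
        rw [Finset.sum_comm]
        simp only [mul_assoc, (h.commRP i _ k _).eq]
      have h1 := h.pinch_le k hT hST
      have h2 := ih hl.2 hs.2 hil hjl
      have h3 := hs.1 j hjl
      rw [hE]
      rw [opExp_sum ψ _ (fun a => X a * R i a)] at h1
      have h4 := (abs_sub_le _ _ _).trans (add_le_add h1 h2)
      push_cast [List.length_cons]
      linarith

theorem abs_opExp_seqMeas_sub_le (h : IsTriple P R S ψ) {G : A → A → ℝ}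
    (hG : ∀ a b, |G a b| ≤ 1) {i j : Q} {δ : ℝ} (hδi : stepError P R ψ i ≤ δ)
    (hδj : stepError P R ψ j ≤ δ) (l : List Q) (hl : l.Nodup)
    (hs : l.Pairwise fun x y => stepError P R ψ x ≤ stepError P R ψ y) (hi : i ∈ l) (hj : j ∈ l)
    (f : Q → A) :
    |opExp ψ (seqMeas P (fun f => G (f i) (f j)) l f)
      - ∑ a, ∑ b, G a b * opExp ψ (P i a * R j b)| ≤ l.length * δ := by
  have hδ : 0 ≤ δ := (stepError_nonneg P R ψ i).trans hδi
  induction l generalizing f with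
  | nil => simp at hj
  | cons k l ih =>
    rw [List.nodup_cons] at hl
    rw [List.pairwise_cons] at hs
    have hcontr (G : A → A → ℝ) (hG : ∀ a b, |G a b| ≤ 1) (i j : Q) (f : Q → A) :
        IsContr (seqMeas P (fun f => G (f i) (f j)) l f) :=
      isContr_seqMeas h.measP (fun f => hG _ _) l _
    have first (G : A → A → ℝ) (hG : ∀ a b, |G a b| ≤ 1) (j : Q) (hδk : stepError P R ψ k ≤ δ)
        (hδj : stepError P R ψ j ≤ δ) (hj : j ∈ l) :
        |opExp ψ (seqMeas P (fun f => G (f k) (f j)) (k :: l) f)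
          - ∑ a, ∑ b, G a b * opExp ψ (P k a * R j b)| ≤ (k :: l).length * δ := by
      have h1 := h.transfer_le k (fun a => hcontr G hG k j (Function.update f k a))
        fun a => commute_seqMeas (fun q c => h.commRP k a q c) _ l _
      have h2 := h.abs_sum_opExp_seqMeas_mul_sub_le hG l hl.2 hs.2 hl.1 hj f
      have h3 := mul_le_mul_of_nonneg_left hδj (Nat.cast_nonneg (α := ℝ) l.length)
      have h4 := (abs_sub_le _ _ _).trans (add_le_add h1 h2)
      rw [seqMeas]
      push_cast [List.length_cons]
      linarith
    by_cases hki : k = i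
    · subst hki
      by_cases hkj : k = j
      · subst hkj
        set X : A → K →L[ℂ] K := fun a => ∑ b, (G a b : ℂ) • P k b with hX
        have hE : seqMeas P (fun f => G (f k) (f k)) (k :: l) f = ∑ a, P k a * X a * P k a := by
          rw [seqMeas]
          refine Finset.sum_congr rfl fun a _ => ?_
          rw [seqMeas_eq_smul_one h.measP (dependsOn_pair G k k) l (by simpa using hl.1)]
          simp only [hX, Finset.mul_sum, Finset.sum_mul, mul_smul_comm, smul_mul_assoc]
          rw [Finset.sum_eq_single a]
          · simp [((h.measP k).proj a).isIdempotentElem.eq]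
          · intro b _ hb
            rw [(h.measP k).mul_eq_zero hb]
            simp
          · simp
        have hXc (a : A) : IsContr (X a) := by
          have := (h.measP k).isContr_pinch (X := fun b => (G a b : ℂ) • 1) fun b v => by
            simpa [norm_smul] using mul_le_mul_of_nonneg_right (hG a b) (norm_nonneg v)
          simpa only [mul_smul_comm, smul_mul_assoc, mul_one,
            ((h.measP k).proj _).isIdempotentElem.eq] using this
        have h1 := h.transfer_le k hXc fun a =>
          Commute.sum_right _ _ _ fun b _ => (h.commRP k a k b).smul_right _
        have h2 : ∑ a, opExp ψ (X a * R k a)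
            = ∑ a, ∑ b, G a b * opExp ψ (P k a * R k b) := by
          simp only [hX, Finset.sum_mul, smul_mul_assoc, opExp_sum, opExp_smul, h.symm k _ k]
        rw [h2] at h1
        rw [hE]
        push_cast [List.length_cons]
        have : 0 ≤ l.length * δ := by positivity
        linarith
      · exact first G hG j hδi hδj (by simpa [Ne.symm hkj] using hj)
    · have hil : i ∈ l := by simpa [Ne.symm hki] using hi
      by_cases hkj : k = j
      · subst hkj
        have h1 := first (fun a b => G b a) (fun a b => hG b a) i hδj hδi hil
        rw [Finset.sum_comm] at h1
        simpa only [h.symm k _ i] using h1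
      · have hjl : j ∈ l := by simpa [Ne.symm hkj] using hj
        have hE (a : A) : seqMeas P (fun f => G (f i) (f j)) l (Function.update f k a)
            = seqMeas P (fun f => G (f i) (f j)) l f := by
          refine seqMeas_congr (dependsOn_pair G i j) l ?_
          rintro x (rfl | rfl) hx
          exacts [absurd hil hx, absurd hjl hx]
        have h1 := h.pinch_le k (hcontr G hG i j f) fun a =>
          commute_seqMeas (fun q c => h.commSP k a q c) _ l f
        have h2 := ih hl.2 hs.2 hil hjl f
        have h4 := (abs_sub_le _ _ _).trans (add_le_add h1 h2)
        have h5 := (hs.1 i hil).trans hδi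
        simp only [seqMeas, hE]
        push_cast [List.length_cons]
        linarith

end IsTriple

end SequentialMeasurement

theorem IsTriple.sub_le_of_forall_assignment {K Q A : Type*} [NormedAddCommGroup K]
    [InnerProductSpace ℂ K] [CompleteSpace K] [Fintype Q] [Fintype A] [Nonempty A]
    {P R S : Q → A → K →L[ℂ] K} {ψ : K} (h : IsTriple P R S ψ) {π : Q → Q → ℝ}
    (hπ : ∀ q q', 0 ≤ π q q') {G : Q → Q → A → A → ℝ} (hG : ∀ q q' a a', |G q q' a a'| ≤ 1) {c : ℝ}
    (hc : ∀ f : Q → A, ∑ q, ∑ q', π q q' * G q q' (f q) (f q') ≤ c) :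
    (∑ q, ∑ q', π q q' * ∑ a, ∑ a', G q q' a a' * opExp ψ (P q a * R q' a'))
      - Fintype.card Q * ∑ q, ∑ q', π q q' * (stepError P R ψ q + stepError P R ψ q') ≤ c := by
  classical
  set δ := stepError P R ψ
  set l : List Q := (Finset.univ.toList).insertionSort fun x y => δ x ≤ δ y
  have hperm : l.Perm Finset.univ.toList := List.perm_insertionSort _ _
  have hnd : l.Nodup := hperm.nodup_iff.mpr (Finset.nodup_toList _)
  have hmem (q : Q) : q ∈ l := hperm.mem_iff.mpr (by simp)
  have hlen : l.length = Fintype.card Q := by rw [hperm.length_eq]; simp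
  have : Std.Total fun x y : Q => δ x ≤ δ y := ⟨fun _ _ => le_total _ _⟩
  have : IsTrans Q fun x y => δ x ≤ δ y := ⟨fun _ _ _ => le_trans⟩
  have hsort : l.Pairwise fun x y => δ x ≤ δ y := List.pairwise_insertionSort _ _
  let f₀ : Q → A := fun _ => Classical.arbitrary A
  have h1 := opExp_seqMeas_le h.measP
    (F := fun f => ∑ p : Q × Q, π p.1 p.2 * G p.1 p.2 (f p.1) (f p.2)) (c := c)
    (fun f => by rw [Fintype.sum_prod_type]; exact hc f) l f₀ ψ
  rw [seqMeas_sum, opExp_sum, h.norm_eq, one_pow, mul_one, Fintype.sum_prod_type] at h1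
  simp only [opExp_smul] at h1
  refine le_trans ?_ h1
  rw [Finset.mul_sum, ← Finset.sum_sub_distrib]
  refine Finset.sum_le_sum fun q _ => ?_
  rw [Finset.mul_sum, ← Finset.sum_sub_distrib]
  refine Finset.sum_le_sum fun q' _ => ?_
  have hq : 0 ≤ δ q := stepError_nonneg P R ψ q
  have hq' : 0 ≤ δ q' := stepError_nonneg P R ψ q'
  have h2 := h.abs_opExp_seqMeas_sub_le (hG q q') (i := q) (j := q') (δ := δ q + δ q')
    (by simp only [δ] at *; linarith) (by simp only [δ] at *; linarith) l hnd hsort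
    (hmem q) (hmem q') f₀
  rw [hlen] at h2
  have h3 := mul_le_mul_of_nonneg_left (sub_le_of_abs_sub_le_left h2) (hπ q q')
  refine le_trans (le_of_eq ?_) h3
  ring

theorem opExp_toEuclideanCLM {ι : Type*} [Fintype ι] [DecidableEq ι] (M : Matrix ι ι ℂ)
    (ψ : ι → ℂ) : opExp (WithLp.toLp 2 ψ) (Matrix.toEuclideanCLM (𝕜 := ℂ) M) = expval M ψ := by
  rw [opExp, expval, Matrix.toEuclideanCLM_toLp, PiLp.inner_apply]
  congr 1
  refine Finset.sum_congr rfl fun i _ => ?_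
  rw [RCLike.inner_apply']

theorem norm_toLp_of_nsq_eq_one {ι : Type*} [Fintype ι] {ψ : ι → ℂ} (h : nsq ψ = 1) :
    ‖WithLp.toLp 2 ψ‖ = 1 := by
  rw [← sq_eq_sq₀ (norm_nonneg _) zero_le_one, EuclideanSpace.norm_sq_eq, one_pow]
  exact h

theorem expval_submatrix {ι : Type*} [Fintype ι] (M : Matrix ι ι ℂ) {ψ : ι → ℂ} (e : ι ≃ ι)
    (he : ∀ i, ψ (e i) = ψ i) : expval (M.submatrix e e) ψ = expval M ψ := by
  unfold expval
  congr 1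
  rw [← e.sum_comp fun p => (starRingEnd ℂ) (ψ p) * M.mulVec ψ p]
  refine Finset.sum_congr rfl fun i _ => ?_
  rw [he, Matrix.mulVec, Matrix.mulVec, dotProduct, dotProduct,
    ← e.sum_comp fun j => M (e i) j * ψ j]
  simp [he]

theorem IsProjMeas.isStarProjection {n A : Type*} [Fintype n] [DecidableEq n] [Fintype A]
    {W : A → Matrix n n ℂ} (hW : IsProjMeas W) (a : A) : IsStarProjection (W a) :=
  ⟨hW.2.1 a, hW.1 a⟩

theorem IsStarProjection.kronecker {m n : Type*} [Fintype m] [Fintype n]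
    {B : Matrix m m ℂ} {C : Matrix n n ℂ} (hB : IsStarProjection B) (hC : IsStarProjection C) :
    IsStarProjection (B ⊗ₖ C) := by
  refine ⟨?_, ?_⟩
  · rw [IsIdempotentElem, ← Matrix.mul_kronecker_mul, hB.isIdempotentElem.eq,
      hC.isIdempotentElem.eq]
  · rw [IsSelfAdjoint, Matrix.star_eq_conjTranspose, Matrix.conjTranspose_kronecker]
    congr 1
    exacts [hB.isSelfAdjoint, hC.isSelfAdjoint]

theorem IsProjMeas.kronecker_one {m n A : Type*} [Fintype m] [DecidableEq m] [Fintype n]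
    [DecidableEq n] [Fintype A] {W : A → Matrix m m ℂ} (hW : IsProjMeas W) :
    IsProjMeas fun a => W a ⊗ₖ (1 : Matrix n n ℂ) := by
  have h (a : A) := (hW.isStarProjection a).kronecker (.one (Matrix n n ℂ))
  refine ⟨fun a => (h a).isSelfAdjoint, fun a => (h a).isIdempotentElem, ?_⟩
  rw [← Matrix.one_kronecker_one, ← hW.2.2]
  ext i j
  simp [Matrix.sum_apply, Finset.sum_mul]

theorem IsProjMeas.one_kronecker {m n A : Type*} [Fintype m] [DecidableEq m] [Fintype n]
    [DecidableEq n] [Fintype A] {W : A → Matrix m m ℂ} (hW : IsProjMeas W) :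
    IsProjMeas fun a => (1 : Matrix n n ℂ) ⊗ₖ W a := by
  have h (a : A) := (IsStarProjection.one (Matrix n n ℂ)).kronecker (hW.isStarProjection a)
  refine ⟨fun a => (h a).isSelfAdjoint, fun a => (h a).isIdempotentElem, ?_⟩
  rw [← Matrix.one_kronecker_one, ← hW.2.2]
  ext i j
  simp [Matrix.sum_apply, Finset.mul_sum]

theorem IsProjMeas.isOpMeas {n A : Type*} [Fintype n] [DecidableEq n] [Fintype A]
    {W : A → Matrix n n ℂ} (hW : IsProjMeas W) :
    IsOpMeas fun a => Matrix.toEuclideanCLM (𝕜 := ℂ) (W a) where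
  proj a := (hW.isStarProjection a).map Matrix.toEuclideanCLM
  sum_eq := by rw [← map_sum, hW.2.2, map_one]

section Registers

variable {d : ℕ}

/-- The operator `B` acting on the first of three registers. -/
noncomputable def reg₁ (B : Matrix (Fin d) (Fin d) ℂ) :
    Matrix (Fin d × Fin d × Fin d) (Fin d × Fin d × Fin d) ℂ :=
  B ⊗ₖ ((1 : Matrix (Fin d) (Fin d) ℂ) ⊗ₖ (1 : Matrix (Fin d) (Fin d) ℂ))

/-- The operator `B` acting on the second of three registers. -/
noncomputable def reg₂ (B : Matrix (Fin d) (Fin d) ℂ) :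
    Matrix (Fin d × Fin d × Fin d) (Fin d × Fin d × Fin d) ℂ :=
  (1 : Matrix (Fin d) (Fin d) ℂ) ⊗ₖ (B ⊗ₖ (1 : Matrix (Fin d) (Fin d) ℂ))

/-- The operator `B` acting on the third of three registers. -/
noncomputable def reg₃ (B : Matrix (Fin d) (Fin d) ℂ) :
    Matrix (Fin d × Fin d × Fin d) (Fin d × Fin d × Fin d) ℂ :=
  (1 : Matrix (Fin d) (Fin d) ℂ) ⊗ₖ ((1 : Matrix (Fin d) (Fin d) ℂ) ⊗ₖ B)

theorem reg₁_mul_reg₂ (B C : Matrix (Fin d) (Fin d) ℂ) :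
    reg₁ B * reg₂ C = B ⊗ₖ (C ⊗ₖ (1 : Matrix (Fin d) (Fin d) ℂ)) := by
  simp only [reg₁, reg₂, ← Matrix.mul_kronecker_mul, mul_one, one_mul]

theorem reg₁_mul_reg₃ (B C : Matrix (Fin d) (Fin d) ℂ) :
    reg₁ B * reg₃ C = B ⊗ₖ ((1 : Matrix (Fin d) (Fin d) ℂ) ⊗ₖ C) := by
  simp only [reg₁, reg₃, ← Matrix.mul_kronecker_mul, mul_one, one_mul]

theorem commute_reg₂_reg₁ (B C : Matrix (Fin d) (Fin d) ℂ) : Commute (reg₂ B) (reg₁ C) := by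
  simp only [Commute, SemiconjBy, reg₁, reg₂, ← Matrix.mul_kronecker_mul, mul_one, one_mul]

theorem commute_reg₃_reg₁ (B C : Matrix (Fin d) (Fin d) ℂ) : Commute (reg₃ B) (reg₁ C) := by
  simp only [Commute, SemiconjBy, reg₁, reg₃, ← Matrix.mul_kronecker_mul, mul_one, one_mul]

theorem commute_reg₃_reg₂ (B C : Matrix (Fin d) (Fin d) ℂ) : Commute (reg₃ B) (reg₂ C) := by
  simp only [Commute, SemiconjBy, reg₂, reg₃, ← Matrix.mul_kronecker_mul, mul_one, one_mul]

theorem expval_swap₁₂ {ψ : Fin d × Fin d × Fin d → ℂ} (hψ : ∀ i j k, ψ (i, j, k) = ψ (j, i, k))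
    (B C D : Matrix (Fin d) (Fin d) ℂ) :
    expval (B ⊗ₖ (C ⊗ₖ D)) ψ = expval (C ⊗ₖ (B ⊗ₖ D)) ψ := by
  let e : Fin d × Fin d × Fin d ≃ Fin d × Fin d × Fin d :=
    ⟨fun p => (p.2.1, p.1, p.2.2), fun p => (p.2.1, p.1, p.2.2), fun _ => rfl, fun _ => rfl⟩
  rw [← expval_submatrix _ e fun i => hψ _ _ _]
  congr 1
  ext i j
  simp only [Matrix.submatrix_apply, Matrix.kroneckerMap_apply, e, Equiv.coe_fn_mk]
  ring

theorem expval_swap₂₃ {ψ : Fin d × Fin d × Fin d → ℂ} (hψ : ∀ i j k, ψ (i, j, k) = ψ (i, k, j))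
    (B C D : Matrix (Fin d) (Fin d) ℂ) :
    expval (B ⊗ₖ (C ⊗ₖ D)) ψ = expval (B ⊗ₖ (D ⊗ₖ C)) ψ := by
  let e : Fin d × Fin d × Fin d ≃ Fin d × Fin d × Fin d :=
    ⟨fun p => (p.1, p.2.2, p.2.1), fun p => (p.1, p.2.2, p.2.1), fun _ => rfl, fun _ => rfl⟩
  rw [← expval_submatrix _ e fun i => hψ _ _ _]
  congr 1
  ext i j
  simp only [Matrix.submatrix_apply, Matrix.kroneckerMap_apply, e, Equiv.coe_fn_mk]
  ring

theorem opExp_reg₁_mul_reg₂ (B C : Matrix (Fin d) (Fin d) ℂ) (ψ : Fin d × Fin d × Fin d → ℂ) :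
    opExp (WithLp.toLp 2 ψ)
        (Matrix.toEuclideanCLM (𝕜 := ℂ) (reg₁ B) * Matrix.toEuclideanCLM (𝕜 := ℂ) (reg₂ C))
      = expval (B ⊗ₖ (C ⊗ₖ (1 : Matrix (Fin d) (Fin d) ℂ))) ψ := by
  rw [← map_mul, opExp_toEuclideanCLM, reg₁_mul_reg₂]

theorem isTriple_reg {Q A : Type*} [Fintype A] {ψ : Fin d × Fin d × Fin d → ℂ}
    (hunit : nsq ψ = 1) (hsym12 : ∀ i j k, ψ (i, j, k) = ψ (j, i, k))
    (hsym23 : ∀ i j k, ψ (i, j, k) = ψ (i, k, j)) {W : Q → A → Matrix (Fin d) (Fin d) ℂ}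
    (hW : ∀ q, IsProjMeas (W q)) :
    IsTriple (fun q a => Matrix.toEuclideanCLM (𝕜 := ℂ) (reg₁ (W q a)))
      (fun q a => Matrix.toEuclideanCLM (𝕜 := ℂ) (reg₂ (W q a)))
      (fun q a => Matrix.toEuclideanCLM (𝕜 := ℂ) (reg₃ (W q a))) (WithLp.toLp 2 ψ) where
  norm_eq := norm_toLp_of_nsq_eq_one hunit
  measP q := by simpa only [reg₁, Matrix.one_kronecker_one] using (hW q).kronecker_one.isOpMeas
  measR q := (hW q).kronecker_one.one_kronecker.isOpMeas
  measS q := (hW q).one_kronecker.one_kronecker.isOpMeas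
  commRP q a q' a' := (commute_reg₂_reg₁ _ _).map Matrix.toEuclideanCLM
  commSP q a q' a' := (commute_reg₃_reg₁ _ _).map Matrix.toEuclideanCLM
  commSR q a q' a' := (commute_reg₃_reg₂ _ _).map Matrix.toEuclideanCLM
  symm q a q' a' := by simp only [opExp_reg₁_mul_reg₂]; exact expval_swap₁₂ hsym12 _ _ _
  eqS q a := by
    rw [opExp_reg₁_mul_reg₂, ← map_mul, opExp_toEuclideanCLM, reg₁_mul_reg₃]
    exact expval_swap₂₃ hsym23 _ _ _

end Registers

theorem le_gameValue {Q A : Type*} [Fintype Q] [Fintype A] (π : Q → Q → ℝ)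
    (V : A → A → Q → Q → Bool) (f g : Q → A) :
    ∑ q, ∑ q', π q q' * (if V (f q) (g q') q q' then (1 : ℝ) else 0) ≤ gameValue π V :=
  (le_ciSup (f := fun g : Q → A => ∑ q, ∑ q', π q q' *
      (if V (f q) (g q') q q' then (1 : ℝ) else 0)) (Set.finite_range _).bddAbove g).trans
    (le_ciSup (f := fun f : Q → A => ⨆ g : Q → A, ∑ q, ∑ q', π q q' *
      (if V (f q) (g q') q q' then (1 : ℝ) else 0)) (Set.finite_range _).bddAbove f)

theorem stmt5 {d : ℕ} {Q A : Type*} [Fintype Q] [Fintype A]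
    (π : Q → Q → ℝ)
    (hπ0 : ∀ q q', 0 ≤ π q q') (hπ1 : ∑ q, ∑ q', π q q' = 1)
    (hπsym : ∀ q q', π q q' = π q' q)
    (V : A → A → Q → Q → Bool)
    (ψ : Fin d × Fin d × Fin d → ℂ)
    (hunit : nsq ψ = 1)
    -- invariance of ψ under all permutations of the three tensor factors
    (hsym12 : ∀ i j k, ψ (i, j, k) = ψ (j, i, k))
    (hsym23 : ∀ i j k, ψ (i, j, k) = ψ (i, k, j))
    (W : Q → A → Matrix (Fin d) (Fin d) ℂ)
    (hW : ∀ q, IsProjMeas (W q))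
    (ε : ℝ)
    -- the classical test succeeds with probability at least 1 - ε
    (hπ₁ : 1 - ε ≤ ∑ q, ∑ q', π q q' * ∑ a, ∑ a',
        (if V a a' q q' then (1 : ℝ) else 0) *
          expval (W q a ⊗ₖ (W q' a' ⊗ₖ (1 : Matrix (Fin d) (Fin d) ℂ))) ψ)
    -- the consistency test succeeds with probability at least 1 - ε
    (hπ₂ : 1 - ε ≤ ∑ q, (∑ q', π q q') *
        ∑ a, expval (W q a ⊗ₖ (W q a ⊗ₖ (1 : Matrix (Fin d) (Fin d) ℂ))) ψ) :
    1 - ε - 12 * (Fintype.card Q) * Real.sqrt ε ≤ gameValue π V := by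
  have : Nonempty A := by
    by_contra hA
    rw [not_nonempty_iff] at hA
    have hQ : IsEmpty Q := by
      by_contra hQ
      rw [not_isEmpty_iff] at hQ
      obtain ⟨q⟩ := hQ
      have h1 := (hW q).2.2
      have hd : IsEmpty (Fin d) := by
        by_contra hd
        rw [not_isEmpty_iff] at hd
        simp at h1
      simp [nsq] at hunit
    simp at hπ1
  have hT := isTriple_reg hunit hsym12 hsym23 hW
  set P : Q → A → _ := fun q a => Matrix.toEuclideanCLM (𝕜 := ℂ) (reg₁ (W q a))
  set R : Q → A → _ := fun q a => Matrix.toEuclideanCLM (𝕜 := ℂ) (reg₂ (W q a))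
  set φ := WithLp.toLp 2 ψ
  have hPR (q : Q) (a : A) (q' : Q) (a' : A) : opExp φ (P q a * R q' a')
      = expval (W q a ⊗ₖ (W q' a' ⊗ₖ (1 : Matrix (Fin d) (Fin d) ℂ))) ψ :=
    opExp_reg₁_mul_reg₂ _ _ _
  have hround := hT.sub_le_of_forall_assignment hπ0
    (G := fun q q' a a' => if V a a' q q' then (1 : ℝ) else 0)
    (fun q q' a a' => by split_ifs <;> simp) (c := gameValue π V)
    fun f => le_gameValue π V f f
  simp only [← hPR] at hπ₁ hπ₂
  set p : Q → ℝ := fun q => ∑ q', π q q' with hp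
  have hp0 (q : Q) : 0 ≤ p q := Finset.sum_nonneg fun q' _ => hπ0 q q'
  have hcons : ∑ q, p q * inconsistency P R φ q ≤ ε := by
    simp only [inconsistency, mul_sub, mul_one, Finset.sum_sub_distrib]
    have : ∑ q, p q = 1 := hπ1
    linarith
  have hε : 0 ≤ ε :=
    (Finset.sum_nonneg fun q _ => mul_nonneg (hp0 q) (hT.inconsistency_nonneg q)).trans hcons
  have herr : ∑ q, ∑ q', π q q' * (stepError P R φ q + stepError P R φ q')
      = 2 * ∑ q, p q * stepError P R φ q := by
    simp only [mul_add, Finset.sum_add_distrib]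
    rw [two_mul, Finset.sum_comm (f := fun q q' => π q q' * stepError P R φ q')]
    simp only [hp, Finset.sum_mul, fun q q' => hπsym q' q]
  have hjensen : ∑ q, p q * stepError P R φ q ≤ 6 * √ε := by
    have h1 := Real.strictConcaveOn_sqrt.concaveOn.le_map_sum (t := Finset.univ)
      (w := p) (p := fun q => 2 * inconsistency P R φ q) (fun q _ => hp0 q) hπ1
      fun q _ => mul_nonneg zero_le_two (hT.inconsistency_nonneg q)
    simp only [smul_eq_mul] at h1
    have h2 : √(∑ q, p q * (2 * inconsistency P R φ q)) ≤ 3 * √ε := by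
      rw [show (3 : ℝ) = √9 by rw [show (9 : ℝ) = 3 ^ 2 by norm_num]; simp,
        ← Real.sqrt_mul (by norm_num)]
      refine Real.sqrt_le_sqrt ?_
      simp only [mul_left_comm _ (2 : ℝ), ← Finset.mul_sum]
      linarith
    simp only [stepError, mul_left_comm _ (2 : ℝ), ← Finset.mul_sum] at *
    linarith
  rw [herr] at hround
  have := mul_le_mul_of_nonneg_left hjensen (Nat.cast_nonneg (α := ℝ) (Fintype.card Q))
  linarith
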